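/- Let S be a meet-semilattice with least element 0 satisfying the ascending chain condition and let a, b ∈ S. Then (a → b) ∧ b ≈₁ {b}, i.e. every element of {z ∧ b | z ∈ a → b} is ≤ b and there exists z ∈ a → b with b ≤ z ∧ b. -/

import Mathlib

/-- The set of maximal elements of `A`. -/
def MaxSet {S : Type*} [PartialOrder S] (A : Set S) : Set S :=
  {m | m ∈ A ∧ ∀ x ∈ A, m ≤ x → x = m}

/-- The ascending chain condition, stated as: every nonempty subset has a maximal element. -/
def AccMax (S : Type*) [PartialOrder S] : Prop :=
  ∀ A : Set S, A.Nonempty → (MaxSet A).Nonempty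

/-- Unsharp negation: `a⁰ = Max {x | a ⊓ x = ⊥}`. -/
def UNeg {S : Type*} [SemilatticeInf S] [OrderBot S] (a : S) : Set S :=
  MaxSet {x | a ⊓ x = ⊥}

/-- Unsharp implication: `a → b = Max {x | a ⊓ x ≤ b}`. -/
def UImp {S : Type*} [SemilatticeInf S] (a b : S) : Set S :=
  MaxSet {x | a ⊓ x ≤ b}

/-- `A ≤₁ B` : every element of `A` lies below some element of `B`. -/
def Le1 {S : Type*} [Preorder S] (A B : Set S) : Prop :=
  ∀ a ∈ A, ∃ b ∈ B, a ≤ b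

/-- `A ≈₁ B` : `A ≤₁ B` and `B ≤₁ A`. -/
def Approx1 {S : Type*} [Preorder S] (A B : Set S) : Prop :=
  Le1 A B ∧ Le1 B A

/-- Elementwise meet of two sets: `A ∧ B = {a ⊓ b | a ∈ A, b ∈ B}`. -/
def MeetSet {S : Type*} [SemilatticeInf S] (A B : Set S) : Set S :=
  {c | ∃ a ∈ A, ∃ b ∈ B, c = a ⊓ b}

/-- Under the ascending chain condition, every element of `A` lies below a maximal one. -/
theorem AccMax.exists_le_mem_maxSet {S : Type*} [PartialOrder S] (hacc : AccMax S) {A : Set S}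
    {x : S} (hx : x ∈ A) : ∃ m ∈ MaxSet A, x ≤ m := by
  obtain ⟨m, ⟨hmA, hxm⟩, hmax⟩ := hacc {y | y ∈ A ∧ x ≤ y} ⟨x, hx, le_rfl⟩
  exact ⟨m, ⟨hmA, fun y hy hmy => hmax y ⟨hy, hxm.trans hmy⟩ hmy⟩, hxm⟩

theorem stmt15 {S : Type*} [SemilatticeInf S] [OrderBot S] (hacc : AccMax S) (a b : S) :
    Approx1 (MeetSet (UImp a b) {b}) {b} := by
  constructor
  · rintro _ ⟨z, _, _, rfl, rfl⟩
    exact ⟨_, rfl, inf_le_right⟩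
  · rintro x hx
    obtain rfl : x = b := hx
    obtain ⟨z, hz, hxz⟩ := hacc.exists_le_mem_maxSet (A := {y | a ⊓ y ≤ x}) (x := x) inf_le_right
    exact ⟨z ⊓ x, ⟨z, hz, x, rfl, rfl⟩, le_inf hxz le_rfl⟩
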